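/- Let (X, ρ, 𝒞) be a semi-Cartan graph with GRS Δ and Weyl groupoid 𝒲. Let w ∈ 𝒲(y,x) with r := ℓ(w) > 0, and let w = σ_{i_1}^{x_1} σ_{i_2}^{x_2} ⋯ σ_{i_r}^{x_r} and w = σ_{j_1}^{x} σ_{j_2} ⋯ σ_{j_r} be two reduced expressions of w (x_1 = x). Then for every (y,x)-good subsequence a(1) < ⋯ < a(t) of 1,…,r (with respect to the first reduced expression) such that u := σ_{i_{a(1)}}^x σ_{i_{a(2)}} ⋯ σ_{i_{a(t)}} satisfies ℓ(u) = t and u ∈ 𝒲(y,x), there exists a (y,x)-good subsequence b(1) < ⋯ < b(t) of 1,…,r with respect to the second reduced expression such that u = σ_{j_{b(1)}}^x σ_{j_{b(2)}} ⋯ σ_{j_{b(t)}}. Consequently the Bruhat order on 𝒲(y,x) is well defined, independently of the chosen reduced expression. -/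

import Mathlib

open CategoryTheory

noncomputable section

namespace WeylGroupoid

variable {θ : ℕ} {X : Type} [Fintype X] [DecidableEq X]

/-- A *semi-Cartan graph*: a basic datum `(X, ρ)` together with a compatible bundle of
generalized Cartan matrices. -/
structure SCG (θ : ℕ) (X : Type) [Fintype X] [DecidableEq X] : Type where
  nonempty : Nonempty X
  /-- the involutions `ρ_i` of the basic datum -/
  ρ : Fin θ → X → X
  invol : ∀ i x, ρ i (ρ i x) = x
  /-- the bundle of generalized Cartan matrices `C^x` -/
  C : X → Fin θ → Fin θ → ℤ
  diag : ∀ x i, C x i i = 2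
  offdiag : ∀ x i j, i ≠ j → C x i j ≤ 0
  zero_iff : ∀ x i j, i ≠ j → (C x i j = 0 ↔ C x j i = 0)
  compat : ∀ x i j, C (ρ i x) i j = C x i j

/-- the simple root `α_i ∈ ℤ^θ` -/
def al (θ : ℕ) (i : Fin θ) : Fin θ → ℤ := Pi.single i 1

/-- the reflection `s_i^x` of `ℤ^θ`, `s_i^x (α_j) = α_j - c^x_{ij} α_i` -/
def srefl (G : SCG θ X) (x : X) (i : Fin θ) (v : Fin θ → ℤ) : Fin θ → ℤ :=
  fun k => v k - (if k = i then ∑ j, G.C x i j * v j else 0)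

/-- the cone `ℕ₀ α_i + ℕ₀ α_j` -/
def pairCone (θ : ℕ) (i j : Fin θ) : Set (Fin θ → ℤ) :=
  {v | ∃ a b : ℕ, v = (a : ℤ) • al θ i + (b : ℤ) • al θ j}

/-- A *generalized root system* on a semi-Cartan graph. -/
structure GRS (G : SCG θ X) : Type where
  /-- the root sets `Δ^x` -/
  Δ : X → Set (Fin θ → ℤ)
  pos_neg : ∀ x, Δ x = (Δ x ∩ {v | ∀ k, 0 ≤ v k}) ∪ (-(Δ x ∩ {v | ∀ k, 0 ≤ v k}))
  simple : ∀ x i, Δ x ∩ {v | ∃ c : ℤ, v = c • al θ i} = {al θ i, -al θ i}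
  reflect : ∀ x i, (srefl G x i) '' Δ x = Δ (G.ρ i x)
  pairFinite : ∀ x i j, (Δ x ∩ pairCone θ i j).Finite
  loop : ∀ x i j, (fun y => G.ρ i (G.ρ j y))^[(Δ x ∩ pairCone θ i j).ncard] x = x

variable (G : SCG θ X)

/-- The entries `m^x_{ij} = |Δ^x ∩ (ℕ₀α_i + ℕ₀α_j)|`. -/
def mnum (R : GRS G) (x : X) (i j : Fin θ) : ℕ := (R.Δ x ∩ pairCone θ i j).ncard

/-- the set of positive roots `Δ^x_+` -/
def posRoots (R : GRS G) (x : X) : Set (Fin θ → ℤ) := R.Δ x ∩ {v | ∀ k, 0 ≤ v k}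

/-- The objects of the Weyl groupoid (a type synonym for `X` carrying a quiver
structure depending on `G`). -/
def Obj (G : SCG θ X) : Type := X

instance : Quiver (Obj G) := ⟨fun a b => {i : Fin θ // G.ρ i (show X from b) = (show X from a)}⟩

/-- objects of the path category -/
def pob (x : X) : Paths (Obj G) := (x : X)

/-- the generating arrow `σ_i^x : ρ_i(x) → x` -/
def genArrow (x : X) (i : Fin θ) : pob G (G.ρ i x) ⟶ pob G x :=
  Quiver.Path.nil.cons (⟨i, rfl⟩ : (show Obj G from G.ρ i x) ⟶ (show Obj G from x))

/-- the source of the word `σ_{i_1}^x σ_{i_2} ⋯ σ_{i_m}` (with target `x`) -/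
def wsrc (G : SCG θ X) : List (Fin θ) → X → X
  | [], x => x
  | i :: l, x => wsrc G l (G.ρ i x)

/-- the path `σ_{i_1}^x σ_{i_2} ⋯ σ_{i_m} : wsrc(w,x) → x` in the free category -/
def pathOf (G : SCG θ X) : (w : List (Fin θ)) → (x : X) → (pob G (wsrc G w x) ⟶ pob G x)
  | [], _ => 𝟙 _
  | i :: l, x => (pathOf G l (G.ρ i x)) ≫ genArrow G x i


/-- transport a path along an equality of sources -/
def castSrc {a b c : X} (h : a = b) (f : pob G a ⟶ pob G c) : pob G b ⟶ pob G c := by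
  subst h; exact f

/-- the alternating word `[i, j, i, j, …]` of length `n` -/
def altWord (i j : Fin θ) : ℕ → List (Fin θ)
  | 0 => []
  | n + 1 => i :: altWord j i n

/-- The defining relations `(σ_i^x σ_j)^{m^x_{ij}} = id_x` of the Weyl groupoid. -/
inductive wrel (R : GRS G) : HomRel (Paths (Obj G))
  | rel (x : X) (i j : Fin θ)
      (h : wsrc G (altWord i j (2 * mnum G R x i j)) x = x) :
      wrel R (castSrc G h (pathOf G (altWord i j (2 * mnum G R x i j)) x))
        (𝟙 (pob G x))

variable (R : GRS G)

/-- The Weyl groupoid, as the quotient of the free category on the quiver of the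
`σ_i^x` by the relations `(σ_i^x σ_j)^{m^x_{ij}} = id_x` (every generator is invertible
in this quotient, so it is indeed a groupoid). -/
def W := CategoryTheory.Quotient (wrel G R)

instance : Category (W G R) := inferInstanceAs (Category (CategoryTheory.Quotient (wrel G R)))

/-- objects of the Weyl groupoid -/
def objW (x : X) : W G R := ⟨pob G x⟩

/-- hom-sets `𝒲(y, x)` of the Weyl groupoid -/
def homW (y x : X) := objW G R y ⟶ objW G R x

instance {y x : X} : CoeSort (homW G R y x) (objW G R y ⟶ objW G R x) := ⟨id⟩

/-- the morphism of the Weyl groupoid defined by the word `σ_{i_1}^x ⋯ σ_{i_m}` -/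
def morW (w : List (Fin θ)) (x : X) : homW G R (wsrc G w x) x :=
  (Quotient.functor (wrel G R)).map (pathOf G w x)

/-- the generator `σ_i^x : ρ_i(x) → x` in the Weyl groupoid -/
def genW (x : X) (i : Fin θ) : homW G R (G.ρ i x) x :=
  (Quotient.functor (wrel G R)).map (genArrow G x i)

/-- transport a morphism of the Weyl groupoid along an equality of sources -/
def castW {a b c : X} (h : a = b) (f : homW G R a c) : homW G R b c := by
  subst h; exact f

/-- transport a morphism of the Weyl groupoid along an equality of targets -/
def castTgt {a c c' : X} (h : c = c') (f : homW G R a c) : homW G R a c' := by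
  subst h; exact f

/-- the length `ℓ(f)` of a morphism of the Weyl groupoid -/
def len {y x : X} (f : homW G R y x) : ℕ :=
  sInf {n | ∃ w : List (Fin θ), w.length = n ∧
    ∃ h : wsrc G w x = y, castW G R h (morW G R w x) = f}

/-- `w` is a reduced expression of the morphism `f ∈ 𝒲(y,x)` -/
def IsRedEx (w : List (Fin θ)) {y x : X} (f : homW G R y x) : Prop :=
  ∃ h : wsrc G w x = y, castW G R h (morW G R w x) = f ∧ w.length = len G R f


section NilHecke

variable (𝕂 : Type) [CommRing 𝕂]

/-- the generator `e^x` of the free algebra -/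
def eF (x : X) : FreeAlgebra 𝕂 (X ⊕ X × Fin θ) := FreeAlgebra.ι 𝕂 (Sum.inl x)

/-- the generator `n_i^x` of the free algebra -/
def nF (x : X) (i : Fin θ) : FreeAlgebra 𝕂 (X ⊕ X × Fin θ) := FreeAlgebra.ι 𝕂 (Sum.inr (x, i))

/-- the word `n_{i_1}^x n_{i_2} ⋯ n_{i_m}` in the free algebra
(superscripts determined by composability) -/
def nWF (G : SCG θ X) (𝕂 : Type) [CommRing 𝕂] :
    List (Fin θ) → X → FreeAlgebra 𝕂 (X ⊕ X × Fin θ)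
  | [], _ => 1
  | i :: l, x => nF 𝕂 x i * nWF G 𝕂 l (G.ρ i x)

/-- The defining relations of the nil-Hecke algebra of `(X, ρ, 𝒞)`. -/
inductive nrel (R : GRS G) (𝕂 : Type) [CommRing 𝕂] :
    FreeAlgebra 𝕂 (X ⊕ X × Fin θ) → FreeAlgebra 𝕂 (X ⊕ X × Fin θ) → Prop
  | orth (x y : X) (h : x ≠ y) : nrel R 𝕂 (eF 𝕂 x * eF 𝕂 y) 0
  | idem (x : X) : nrel R 𝕂 (eF 𝕂 x * eF 𝕂 x) (eF 𝕂 x)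
  | total : nrel R 𝕂 (∑ x : X, eF 𝕂 x) 1
  | unit_right (x : X) (i : Fin θ) : nrel R 𝕂 (nF 𝕂 x i * eF 𝕂 (G.ρ i x)) (nF 𝕂 x i)
  | unit_left (x : X) (i : Fin θ) : nrel R 𝕂 (eF 𝕂 x * nF 𝕂 x i) (nF 𝕂 x i)
  | nil (x : X) (i : Fin θ) : nrel R 𝕂 (nF 𝕂 (G.ρ i x) i * nF 𝕂 x i) 0
  | braid (x : X) (i j : Fin θ) (hij : i ≠ j) :
      nrel R 𝕂 (nWF G 𝕂 (altWord i j (mnum G R x i j)) x)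
        (nWF G 𝕂 (altWord j i (mnum G R x i j)) x)

/-- The nil-Hecke algebra `𝒩(X, ρ, 𝒞)` of a Weyl groupoid over `𝕂`. -/
def NH := RingQuot (nrel G R 𝕂)

instance : Ring (NH G R 𝕂) := inferInstanceAs (Ring (RingQuot (nrel G R 𝕂)))
instance : Algebra 𝕂 (NH G R 𝕂) := inferInstanceAs (Algebra 𝕂 (RingQuot (nrel G R 𝕂)))

/-- the generator `e^x` of the nil-Hecke algebra -/
def eN (x : X) : NH G R 𝕂 := RingQuot.mkAlgHom 𝕂 (nrel G R 𝕂) (eF 𝕂 x)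

/-- the generator `n_i^x` of the nil-Hecke algebra -/
def nN (x : X) (i : Fin θ) : NH G R 𝕂 := RingQuot.mkAlgHom 𝕂 (nrel G R 𝕂) (nF 𝕂 x i)

/-- the word `n_{i_1}^x n_{i_2} ⋯ n_{i_m}` in the nil-Hecke algebra -/
def nW (w : List (Fin θ)) (x : X) : NH G R 𝕂 := RingQuot.mkAlgHom 𝕂 (nrel G R 𝕂) (nWF G 𝕂 w x)

/-- the set of morphisms of the Weyl groupoid -/
def Mor := Σ (y : X) (x : X), homW G R y x

/-- the free `𝕂`-module `𝕂𝒲` on the set of morphisms of the Weyl groupoid -/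
abbrev KW := Mor G R →₀ 𝕂

/-- the endomorphism `E^x` of `𝕂𝒲` -/
def Emap (x : X) : KW G R 𝕂 →ₗ[𝕂] KW G R 𝕂 :=
  Finsupp.lift (KW G R 𝕂) 𝕂 (Mor G R)
    (fun m => if m.2.1 = x then Finsupp.single m 1 else 0)

/-- the value of the endomorphism `L_i^x` of `𝕂𝒲` on a basis morphism -/
def Lval (x : X) (i : Fin θ) (m : Mor G R) : KW G R 𝕂 :=
  if h : m.2.1 = G.ρ i x then
    (let f' : homW G R m.1 x := castTgt G R h m.2.2 ≫ genW G R x i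
     if len G R m.2.2 < len G R f' then Finsupp.single ⟨m.1, x, f'⟩ 1 else 0)
  else 0

/-- the endomorphism `L_i^x` of `𝕂𝒲` -/
def Lmap (x : X) (i : Fin θ) : KW G R 𝕂 →ₗ[𝕂] KW G R 𝕂 :=
  Finsupp.lift (KW G R 𝕂) 𝕂 (Mor G R) (Lval G R 𝕂 x i)

end NilHecke

end WeylGroupoid


namespace WeylGroupoid

variable {θ : ℕ} {X : Type} [Fintype X] [DecidableEq X]

/-- the subword of `w` given by a set of positions -/
def subword (w : List (Fin θ)) (s : Finset (Fin w.length)) : List (Fin θ) :=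
  ((List.finRange w.length).filter (fun k => k ∈ s)).map w.get

/-- A subsequence (set of positions) of a reduced expression with target `x` is
`(y,x)`-good if at every skipped position the object stays unchanged
(`x_{z+1} = x_z`). -/
def IsGood (G : SCG θ X) (w : List (Fin θ)) (x : X) (s : Finset (Fin w.length)) : Prop :=
  ∀ z : Fin w.length, z ∉ s →
    wsrc G (w.take ((z : ℕ) + 1)) x = wsrc G (w.take (z : ℕ)) x

/-- The set `Θ(x; i_1, …, i_r)` of all morphisms `u ∈ 𝒲(y,x)` obtained as reduced
products over `(y,x)`-good subsequences of the word `w = (i_1, …, i_r)`. -/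
def Theta (G : SCG θ X) (R : GRS G) (w : List (Fin θ)) (x : X) :
    Set (homW G R (wsrc G w x) x) :=
  {u | ∃ s : Finset (Fin w.length), IsGood G w x s ∧ s.card = len G R u ∧
    ∃ h : wsrc G (subword w s) x = wsrc G w x,
      castW G R h (morW G R (subword w s) x) = u}

end WeylGroupoid

namespace WeylGroupoid

section Words

variable {θ : ℕ} {X : Type} [Fintype X] [DecidableEq X] (G : SCG θ X) (R : GRS G)

/-- The morphism of the Weyl groupoid given by a word with target `x`, bundled with its
source. -/
def elt (w : List (Fin θ)) (x : X) : Σ y, homW G R y x := ⟨wsrc G w x, morW G R w x⟩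

variable {G R}

theorem elt_eq_iff {w : List (Fin θ)} {y x : X} {f : homW G R y x} :
    elt G R w x = ⟨y, f⟩ ↔ ∃ h : wsrc G w x = y, castW G R h (morW G R w x) = f := by
  constructor
  · intro h
    obtain ⟨h1, h2⟩ := Sigma.mk.inj_iff.mp h
    subst h1
    exact ⟨rfl, eq_of_heq h2⟩
  · rintro ⟨rfl, rfl⟩
    rfl

theorem wsrc_eq_of_elt_eq {w v : List (Fin θ)} {x : X} (h : elt G R w x = elt G R v x) :
    wsrc G w x = wsrc G v x :=
  congrArg Sigma.fst h

theorem morW_cons (i : Fin θ) (l : List (Fin θ)) (x : X) :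
    morW G R (i :: l) x = (morW G R l (G.ρ i x) ≫ genW G R x i : _ ⟶ _) :=
  (Quotient.functor (wrel G R)).map_comp _ _

theorem elt_cons (i : Fin θ) (l : List (Fin θ)) (x : X) :
    elt G R (i :: l) x =
      ⟨(elt G R l (G.ρ i x)).1, ((elt G R l (G.ρ i x)).2 ≫ genW G R x i : _ ⟶ _)⟩ := by
  unfold elt
  exact Sigma.ext rfl (heq_of_eq (morW_cons i l x))

theorem elt_cons_congr {i : Fin θ} {l l' : List (Fin θ)} {x : X}
    (h : elt G R l (G.ρ i x) = elt G R l' (G.ρ i x)) :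
    elt G R (i :: l) x = elt G R (i :: l') x := by
  rw [elt_cons, elt_cons, h]

theorem elt_append (w v : List (Fin θ)) (x : X) :
    elt G R (w ++ v) x = ⟨wsrc G v (elt G R w x).1,
      (morW G R v (elt G R w x).1 ≫ (elt G R w x).2 : _ ⟶ _)⟩ := by
  induction w generalizing x with
  | nil =>
    refine Sigma.ext rfl (heq_of_eq ?_)
    exact (Category.comp_id (morW G R v x : objW G R _ ⟶ objW G R x)).symm
  | cons i l ih =>
    rw [List.cons_append, elt_cons, elt_cons, ih]
    refine Sigma.ext rfl (heq_of_eq ?_)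
    exact Category.assoc (obj := W G R) _ _ _

theorem elt_append_congr {w w' v : List (Fin θ)} {x : X} (h : elt G R w x = elt G R w' x) :
    elt G R (w ++ v) x = elt G R (w' ++ v) x := by
  rw [elt_append, elt_append, h]

theorem elt_append_congr_right {w v v' : List (Fin θ)} {x : X}
    (h : elt G R v (wsrc G w x) = elt G R v' (wsrc G w x)) :
    elt G R (w ++ v) x = elt G R (w ++ v') x := by
  induction w generalizing x with
  | nil => exact h
  | cons i l ih => exact elt_cons_congr (ih h)

theorem wsrc_append (w v : List (Fin θ)) (x : X) :
    wsrc G (w ++ v) x = wsrc G v (wsrc G w x) := by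
  induction w generalizing x with
  | nil => rfl
  | cons i l ih => exact ih _

theorem wsrc_injective (w : List (Fin θ)) : Function.Injective (wsrc G w) := by
  induction w with
  | nil => exact fun _ _ h => h
  | cons i l ih =>
    intro a b h
    have := ih h
    rw [← G.invol i a, this, G.invol]

theorem al_ne_zero (i : Fin θ) : al θ i ≠ 0 := by
  intro h
  have := congrFun h i
  simp [al] at this

theorem zero_notMem (x : X) (i : Fin θ) : (0 : Fin θ → ℤ) ∉ R.Δ x := by
  intro h
  have h1 : (0 : Fin θ → ℤ) ∈ R.Δ x ∩ {v | ∃ c : ℤ, v = c • al θ i} := ⟨h, 0, by simp⟩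
  rw [R.simple] at h1
  rcases h1 with h1 | h1
  · exact al_ne_zero i h1.symm
  · exact al_ne_zero i (neg_eq_zero.mp (Set.mem_singleton_iff.mp h1).symm)

theorem al_mem (x : X) (i : Fin θ) : al θ i ∈ R.Δ x := by
  have h1 : al θ i ∈ R.Δ x ∩ {v | ∃ c : ℤ, v = c • al θ i} := by
    rw [R.simple]; exact Or.inl rfl
  exact h1.1

theorem al_nonneg (i : Fin θ) : 0 ≤ al θ i := by
  simp [al]

theorem eq_al_of_mem_of_nonneg {x : X} {i : Fin θ} {v : Fin θ → ℤ} (hv : v ∈ R.Δ x)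
    (h0 : 0 ≤ v) (hk : ∀ k, k ≠ i → v k = 0) : v = al θ i := by
  have h1 : v ∈ R.Δ x ∩ {v | ∃ c : ℤ, v = c • al θ i} := by
    refine ⟨hv, v i, ?_⟩
    ext k
    by_cases h : k = i
    · subst h; simp [al]
    · simp [al, hk k h, h]
  rw [R.simple] at h1
  rcases h1 with h1 | h1
  · exact h1
  · have := h0 i
    rw [Set.mem_singleton_iff.mp h1] at this
    simp [al] at this

theorem mnum_self (x : X) (i : Fin θ) : mnum G R x i i = 1 := by
  unfold mnum
  rw [Set.ncard_eq_one]
  refine ⟨al θ i, ?_⟩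
  ext v
  constructor
  · rintro ⟨hv, a, b, rfl⟩
    refine eq_al_of_mem_of_nonneg hv ?_ ?_
    · exact add_nonneg (smul_nonneg (by positivity) (al_nonneg i))
        (smul_nonneg (by positivity) (al_nonneg i))
    · intro k hk
      simp [al, hk]
  · rintro rfl
    exact ⟨al_mem x i, 1, 0, by simp⟩

theorem pairCone_comm (i j : Fin θ) : pairCone θ i j = pairCone θ j i := by
  ext v
  exact ⟨fun ⟨a, b, h⟩ => ⟨b, a, by rw [h, add_comm]⟩, fun ⟨a, b, h⟩ => ⟨b, a, by rw [h, add_comm]⟩⟩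

theorem mnum_comm (x : X) (i j : Fin θ) : mnum G R x i j = mnum G R x j i := by
  unfold mnum
  rw [pairCone_comm]

theorem wsrc_altWord_two_mul (i j : Fin θ) (n : ℕ) (x : X) :
    wsrc G (altWord i j (2 * n)) x = (fun y => G.ρ j (G.ρ i y))^[n] x := by
  induction n generalizing x with
  | zero => rfl
  | succ n ih =>
    rw [Function.iterate_succ_apply, ← ih]
    rfl

variable (R) in
theorem wsrc_altWord_two_mul_mnum (i j : Fin θ) (x : X) :
    wsrc G (altWord i j (2 * mnum G R x i j)) x = x := by
  rw [wsrc_altWord_two_mul, mnum_comm]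
  exact R.loop x j i

theorem map_castSrc {a b c : X} (h : a = b) (f : pob G a ⟶ pob G c) :
    (⟨b, (Quotient.functor (wrel G R)).map (castSrc G h f)⟩ : Σ y, homW G R y c) =
      ⟨a, (Quotient.functor (wrel G R)).map f⟩ := by
  subst h
  rfl

theorem elt_altWord_two_mul (x : X) (i j : Fin θ) :
    elt G R (altWord i j (2 * mnum G R x i j)) x = elt G R [] x := by
  have h := wsrc_altWord_two_mul_mnum R i j x
  refine (map_castSrc h (pathOf G _ x)).symm.trans ?_
  exact Sigma.ext rfl (heq_of_eq (CategoryTheory.Quotient.sound (wrel G R) (wrel.rel x i j h)))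

theorem elt_cons_cons_self (i : Fin θ) (l : List (Fin θ)) (x : X) :
    elt G R (i :: i :: l) x = elt G R l x := by
  have h := elt_altWord_two_mul (R := R) x i i
  rw [mnum_self] at h
  exact elt_append_congr (v := l) h

theorem elt_of_cons_eq {i : Fin θ} {l l' : List (Fin θ)} {x : X}
    (h : elt G R (i :: l) x = elt G R (i :: l') x) :
    elt G R l (G.ρ i x) = elt G R l' (G.ρ i x) := by
  rw [← elt_cons_cons_self i l, ← elt_cons_cons_self i l']
  refine elt_cons_congr ?_
  rw [G.invol]
  exact h

theorem elt_append_reverse (w : List (Fin θ)) (x : X) :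
    elt G R (w.reverse ++ w) x = elt G R [] x := by
  induction w generalizing x with
  | nil => rfl
  | cons i l ih =>
    rw [← ih x, List.reverse_cons, List.append_assoc]
    exact elt_append_congr_right (elt_cons_cons_self i l _)

theorem length_altWord (i j : Fin θ) (n : ℕ) : (altWord i j n).length = n := by
  induction n generalizing i j with
  | zero => rfl
  | succ n ih => simp [altWord, ih]

theorem altWord_add (i j : Fin θ) (n k : ℕ) :
    altWord i j (n + k) = altWord i j n ++
      if Even n then altWord i j k else altWord j i k := by
  induction n generalizing i j with
  | zero => simp [altWord]
  | succ n ih =>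
    rw [Nat.add_right_comm]
    simp only [altWord, ih, List.cons_append, Nat.even_add_one]
    split_ifs <;> simp_all

theorem reverse_altWord (i j : Fin θ) (n : ℕ) :
    (altWord j i n).reverse = if Even n then altWord i j n else altWord j i n := by
  induction n generalizing i j with
  | zero => simp [altWord]
  | succ n ih =>
    have h := altWord_add i j n 1
    have h' := altWord_add j i n 1
    simp only [altWord, List.reverse_cons, ih, Nat.even_add_one] at h h' ⊢
    split_ifs <;> simp_all

theorem altWord_two_mul (i j : Fin θ) (n : ℕ) :
    altWord i j (2 * n) = altWord i j n ++ (altWord j i n).reverse := by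
  rw [two_mul, altWord_add, reverse_altWord]

theorem elt_altWord_comm (x : X) (i j : Fin θ) :
    elt G R (altWord i j (mnum G R x i j)) x = elt G R (altWord j i (mnum G R x i j)) x := by
  set m := mnum G R x i j with hm
  have h1 := elt_altWord_two_mul (R := R) x i j
  rw [← hm, altWord_two_mul] at h1
  have h2 := elt_append_congr (v := altWord j i m) h1
  rw [List.append_assoc] at h2
  have h3 := elt_append_congr_right (R := R) (w := altWord i j m)
    (elt_append_reverse (altWord j i m) (wsrc G (altWord i j m) x))
  rw [h2] at h3
  simpa using h3.symm

end Words

end WeylGroupoid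
namespace WeylGroupoid

section Roots

variable {θ : ℕ} {X : Type} [Fintype X] [DecidableEq X] {G : SCG θ X} {R : GRS G}

theorem srefl_apply_self (x : X) (i : Fin θ) (v : Fin θ → ℤ) :
    srefl G x i v i = v i - ∑ j, G.C x i j * v j := by
  simp [srefl]

theorem srefl_apply_of_ne (x : X) {i k : Fin θ} (h : k ≠ i) (v : Fin θ → ℤ) :
    srefl G x i v k = v k := by
  simp [srefl, h]

theorem srefl_eq (x : X) (i : Fin θ) (v : Fin θ → ℤ) :
    srefl G x i v = v - (∑ j, G.C x i j * v j) • al θ i := by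
  ext k
  by_cases h : k = i
  · subst h; simp [srefl, al]
  · simp [srefl, al, h]

theorem srefl_al_self (x : X) (i : Fin θ) : srefl G x i (al θ i) = -al θ i := by
  rw [srefl_eq]
  have : ∑ j, G.C x i j * al θ i j = 2 := by
    simp [al, Pi.single_apply, G.diag]
  rw [this, two_smul]
  abel

theorem srefl_add (x : X) (i : Fin θ) (u v : Fin θ → ℤ) :
    srefl G x i (u + v) = srefl G x i u + srefl G x i v := by
  simp only [srefl_eq, Pi.add_apply, mul_add, Finset.sum_add_distrib, add_smul]
  abel

theorem srefl_smul (x : X) (i : Fin θ) (c : ℤ) (v : Fin θ → ℤ) :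
    srefl G x i (c • v) = c • srefl G x i v := by
  have : ∑ j, G.C x i j * (c • v) j = c * ∑ j, G.C x i j * v j := by
    rw [Finset.mul_sum]
    refine Finset.sum_congr rfl fun j _ => ?_
    simp only [Pi.smul_apply, smul_eq_mul]
    ring
  rw [srefl_eq, srefl_eq, this, smul_sub, mul_smul]

theorem srefl_srefl (x : X) (i : Fin θ) (v : Fin θ → ℤ) :
    srefl G x i (srefl G x i v) = v := by
  rw [srefl_eq x i v, sub_eq_add_neg, ← neg_smul, srefl_add, srefl_smul, srefl_al_self, srefl_eq]
  module

theorem srefl_ρ (x : X) (i : Fin θ) : srefl G (G.ρ i x) i = srefl G x i := by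
  funext v
  simp only [srefl_eq, G.compat]

variable (G) in
/-- The reflection `s_i^x` as a linear automorphism. -/
def sreflEquiv (x : X) (i : Fin θ) : (Fin θ → ℤ) ≃ₗ[ℤ] (Fin θ → ℤ) where
  toFun := srefl G x i
  invFun := srefl G x i
  map_add' := srefl_add x i
  map_smul' := srefl_smul x i
  left_inv := srefl_srefl x i
  right_inv := srefl_srefl x i

variable (G) in
/-- The inverse of the linear map `s_{i_1}^x s_{i_2} ⋯ s_{i_m}` attached to a word with
target `x`. -/
def invAct : List (Fin θ) → X → (Fin θ → ℤ) ≃ₗ[ℤ] (Fin θ → ℤ)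
  | [], _ => LinearEquiv.refl ℤ _
  | i :: l, x => (sreflEquiv G x i).trans (invAct l (G.ρ i x))

theorem invAct_nil (x : X) (v : Fin θ → ℤ) : invAct G [] x v = v := rfl

theorem invAct_cons (i : Fin θ) (l : List (Fin θ)) (x : X) (v : Fin θ → ℤ) :
    invAct G (i :: l) x v = invAct G l (G.ρ i x) (srefl G x i v) := rfl

theorem nonneg_or_nonpos {x : X} {v : Fin θ → ℤ} (hv : v ∈ R.Δ x) : 0 ≤ v ∨ v ≤ 0 := by
  rw [R.pos_neg] at hv
  rcases hv with hv | hv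
  · exact Or.inl hv.2
  · exact Or.inr (neg_nonneg.mp hv.2)

theorem neg_mem {x : X} {v : Fin θ → ℤ} (hv : v ∈ R.Δ x) : -v ∈ R.Δ x := by
  rw [R.pos_neg] at hv ⊢
  rcases hv with hv | hv
  · exact Or.inr (by simpa using hv)
  · exact Or.inl hv

theorem nonneg_of_pos {x : X} {v : Fin θ → ℤ} (hv : v ∈ R.Δ x) {k : Fin θ} (h : 0 < v k) :
    0 ≤ v :=
  (nonneg_or_nonpos hv).resolve_right fun h' => absurd (h' k) (not_le.mpr h)

theorem not_nonpos_iff {x : X} (i : Fin θ) {v : Fin θ → ℤ} (hv : v ∈ R.Δ x) :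
    ¬ v ≤ 0 ↔ 0 ≤ v := by
  refine ⟨(nonneg_or_nonpos hv).resolve_right, fun h h' => ?_⟩
  exact zero_notMem x i (le_antisymm h' h ▸ hv)

theorem srefl_mem_iff {x : X} {i : Fin θ} {v : Fin θ → ℤ} :
    srefl G x i v ∈ R.Δ (G.ρ i x) ↔ v ∈ R.Δ x := by
  rw [← R.reflect x i]
  exact Function.Injective.mem_set_image (Function.LeftInverse.injective (srefl_srefl x i))

theorem invAct_mem_iff {w : List (Fin θ)} {x : X} {v : Fin θ → ℤ} :
    invAct G w x v ∈ R.Δ (wsrc G w x) ↔ v ∈ R.Δ x := by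
  induction w generalizing x v with
  | nil => rfl
  | cons i l ih => exact ih.trans srefl_mem_iff

theorem exists_pos_of_ne_al {x : X} {i : Fin θ} {v : Fin θ → ℤ} (hv : v ∈ R.Δ x)
    (h0 : 0 ≤ v) (hne : v ≠ al θ i) : ∃ k, k ≠ i ∧ 0 < v k := by
  by_contra! h
  exact hne (eq_al_of_mem_of_nonneg hv h0 fun k hk => le_antisymm (h k hk) (h0 k))

/-- A simple reflection permutes the positive roots other than its simple root. -/
theorem srefl_nonneg {x : X} {i : Fin θ} {v : Fin θ → ℤ} (hv : v ∈ R.Δ x)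
    (h0 : 0 ≤ v) (hne : v ≠ al θ i) : 0 ≤ srefl G x i v ∧ srefl G x i v ≠ al θ i := by
  obtain ⟨k, hk, hpos⟩ := exists_pos_of_ne_al hv h0 hne
  rw [← srefl_apply_of_ne (G := G) x hk v] at hpos
  refine ⟨nonneg_of_pos (srefl_mem_iff.mpr hv) hpos, fun h => ?_⟩
  rw [h] at hpos
  simp [al, hk] at hpos

variable (R) in
/-- The positive roots at the target of a word that its inverse makes negative. -/
def inversions (w : List (Fin θ)) (x : X) : Set (Fin θ → ℤ) :=
  {v | v ∈ R.Δ x ∧ 0 ≤ v ∧ invAct G w x v ≤ 0}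

theorem al_mem_inversions {w : List (Fin θ)} {x : X} {i : Fin θ} :
    al θ i ∈ inversions R w x ↔ invAct G w x (al θ i) ≤ 0 :=
  ⟨fun h => h.2.2, fun h => ⟨al_mem x i, al_nonneg i, h⟩⟩

theorem al_mem_inversions_cons {l : List (Fin θ)} {x : X} {i : Fin θ} :
    al θ i ∈ inversions R (i :: l) x ↔ al θ i ∉ inversions R l (G.ρ i x) := by
  rw [al_mem_inversions, al_mem_inversions,
    not_nonpos_iff (R := R) i (invAct_mem_iff.mpr (al_mem _ i)), invAct_cons, srefl_al_self,
    map_neg, neg_nonpos]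

theorem srefl_mem_inversions {l : List (Fin θ)} {x : X} {i : Fin θ} {v : Fin θ → ℤ}
    (hv : v ∈ inversions R (i :: l) x) (hne : v ≠ al θ i) :
    srefl G x i v ∈ inversions R l (G.ρ i x) :=
  ⟨srefl_mem_iff.mpr hv.1, (srefl_nonneg hv.1 hv.2.1 hne).1, hv.2.2⟩

theorem srefl_mem_inversions_cons {l : List (Fin θ)} {x : X} {i : Fin θ} {v : Fin θ → ℤ}
    (hv : v ∈ inversions R l (G.ρ i x)) (hne : v ≠ al θ i) :
    srefl G x i v ∈ inversions R (i :: l) x := by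
  have h := srefl_nonneg (G := G) hv.1 hv.2.1 hne
  rw [srefl_ρ] at h
  refine ⟨?_, h.1, ?_⟩
  · rw [← srefl_mem_iff (i := i), srefl_srefl]
    exact hv.1
  · rw [invAct_cons, srefl_srefl]
    exact hv.2.2

theorem inversions_cons_diff (l : List (Fin θ)) (x : X) (i : Fin θ) :
    inversions R (i :: l) x \ {al θ i} =
      srefl G x i '' (inversions R l (G.ρ i x) \ {al θ i}) := by
  ext v
  constructor
  · rintro ⟨hv, hne⟩
    exact ⟨_, ⟨srefl_mem_inversions hv hne, (srefl_nonneg hv.1 hv.2.1 hne).2⟩, srefl_srefl x i v⟩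
  · rintro ⟨v, ⟨hv, hne⟩, rfl⟩
    refine ⟨srefl_mem_inversions_cons hv hne, ?_⟩
    have h := srefl_nonneg (G := G) hv.1 hv.2.1 hne
    rw [srefl_ρ] at h
    exact h.2

theorem ncard_inversions_cons_diff (l : List (Fin θ)) (x : X) (i : Fin θ) :
    (inversions R (i :: l) x \ {al θ i}).ncard =
      (inversions R l (G.ρ i x) \ {al θ i}).ncard := by
  rw [inversions_cons_diff,
    Set.ncard_image_of_injective _ (Function.LeftInverse.injective (srefl_srefl x i))]

theorem ncard_inversions_cons_of_notMem {l : List (Fin θ)} {x : X} {i : Fin θ}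
    (hfin : (inversions R (i :: l) x).Finite)
    (h : al θ i ∉ inversions R l (G.ρ i x)) :
    (inversions R (i :: l) x).ncard = (inversions R l (G.ρ i x)).ncard + 1 := by
  rw [← Set.ncard_sdiff_singleton_add_one (al_mem_inversions_cons.mpr h) hfin,
    ncard_inversions_cons_diff, Set.sdiff_singleton_eq_self h]

theorem ncard_inversions_cons_of_mem {l : List (Fin θ)} {x : X} {i : Fin θ}
    (hfin : (inversions R l (G.ρ i x)).Finite)
    (h : al θ i ∈ inversions R l (G.ρ i x)) :
    (inversions R (i :: l) x).ncard + 1 = (inversions R l (G.ρ i x)).ncard := by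
  have h' : al θ i ∉ inversions R (i :: l) x := fun h' => al_mem_inversions_cons.mp h' h
  rw [← Set.ncard_sdiff_singleton_add_one h hfin, ← ncard_inversions_cons_diff,
    Set.sdiff_singleton_eq_self h']

theorem mem_pairCone_iff {i j : Fin θ} (hij : i ≠ j) {v : Fin θ → ℤ} :
    v ∈ pairCone θ i j ↔ 0 ≤ v ∧ ∀ k, k ≠ i → k ≠ j → v k = 0 := by
  constructor
  · rintro ⟨a, b, rfl⟩
    refine ⟨add_nonneg (smul_nonneg (by positivity) (al_nonneg i))
      (smul_nonneg (by positivity) (al_nonneg j)), ?_⟩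
    intro k hi hj
    simp [al, hi, hj]
  · rintro ⟨h0, h⟩
    refine ⟨(v i).toNat, (v j).toNat, ?_⟩
    ext k
    have hi := h0 i
    have hj := h0 j
    simp only [Pi.zero_apply] at hi hj
    by_cases hki : k = i
    · subst hki; simp [al, hij, hi]
    · by_cases hkj : k = j
      · subst hkj; simp [al, hij.symm, hj]
      · simp [al, hki, hkj, h k hki hkj]

theorem eq_smul_al_add_smul_al {i j : Fin θ} (hij : i ≠ j) {v : Fin θ → ℤ}
    (h : ∀ k, k ≠ i → k ≠ j → v k = 0) : v = v i • al θ i + v j • al θ j := by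
  ext k
  by_cases hki : k = i
  · subst hki; simp [al, hij]
  · by_cases hkj : k = j
    · subst hkj; simp [al, hij.symm]
    · simp [al, hki, hkj, h k hki hkj]

theorem srefl_mem_pair {x : X} {i j : Fin θ} (hij : i ≠ j) {v : Fin θ → ℤ}
    (hv : v ∈ R.Δ x ∩ pairCone θ i j) (hne : v ≠ al θ i) :
    srefl G x i v ∈ (R.Δ (G.ρ i x) ∩ pairCone θ i j) \ {al θ i} := by
  have h := (mem_pairCone_iff hij).mp hv.2
  obtain ⟨h1, h2⟩ := srefl_nonneg (G := G) hv.1 h.1 hne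
  refine ⟨⟨srefl_mem_iff.mpr hv.1, (mem_pairCone_iff hij).mpr ⟨h1, fun k hi hj => ?_⟩⟩, h2⟩
  rw [srefl_apply_of_ne x hi, h.2 k hi hj]

theorem al_mem_pairCone_left (i j : Fin θ) : al θ i ∈ pairCone θ i j := ⟨1, 0, by simp⟩

theorem al_mem_pairCone_right (i j : Fin θ) : al θ j ∈ pairCone θ i j := ⟨0, 1, by simp⟩

theorem mnum_pos (x : X) (i j : Fin θ) : 0 < mnum G R x i j :=
  (Set.ncard_pos (R.pairFinite x i j)).mpr ⟨_, al_mem x i, al_mem_pairCone_left i j⟩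

theorem mnum_ρ_left (x : X) {i j : Fin θ} (hij : i ≠ j) :
    mnum G R (G.ρ i x) i j = mnum G R x i j := by
  have h : (R.Δ (G.ρ i x) ∩ pairCone θ i j) \ {al θ i} =
      srefl G x i '' ((R.Δ x ∩ pairCone θ i j) \ {al θ i}) := by
    ext v
    constructor
    · rintro ⟨hv, hne⟩
      refine ⟨srefl G x i v, ?_, srefl_srefl x i v⟩
      have := srefl_mem_pair hij hv hne
      rwa [srefl_ρ, G.invol] at this
    · rintro ⟨v, ⟨hv, hne⟩, rfl⟩
      exact srefl_mem_pair hij hv hne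
  have hmem : ∀ z, al θ i ∈ R.Δ z ∩ pairCone θ i j :=
    fun z => ⟨al_mem z i, al_mem_pairCone_left i j⟩
  unfold mnum
  rw [← Set.ncard_sdiff_singleton_add_one (hmem (G.ρ i x)) (R.pairFinite _ i j), h,
    Set.ncard_image_of_injective _ (Function.LeftInverse.injective (srefl_srefl x i)),
    Set.ncard_sdiff_singleton_add_one (hmem x) (R.pairFinite _ i j)]

theorem mnum_swap_ρ (x : X) {i j : Fin θ} (hij : i ≠ j) :
    mnum G R (G.ρ i x) j i = mnum G R x i j := by
  rw [mnum_comm, mnum_ρ_left x hij]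

theorem invAct_altWord_apply {i j k : Fin θ} (hi : k ≠ i) (hj : k ≠ j) (n : ℕ) (x : X)
    (v : Fin θ → ℤ) : invAct G (altWord i j n) x v k = v k := by
  induction n generalizing i j x v with
  | zero => rfl
  | succ n ih =>
    rw [altWord, invAct_cons, ih hj hi, srefl_apply_of_ne x hi]

theorem inversions_altWord_subset {i j : Fin θ} (hij : i ≠ j) (n : ℕ) (x : X) :
    inversions R (altWord i j n) x ⊆ R.Δ x ∩ pairCone θ i j := by
  rintro v ⟨hv, h0, hn⟩
  refine ⟨hv, (mem_pairCone_iff hij).mpr ⟨h0, fun k hi hj => le_antisymm ?_ (h0 k)⟩⟩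
  have := hn k
  rwa [invAct_altWord_apply hi hj] at this

theorem finite_inversions_altWord {i j : Fin θ} (hij : i ≠ j) (n : ℕ) (x : X) :
    (inversions R (altWord i j n) x).Finite :=
  (R.pairFinite x i j).subset (inversions_altWord_subset hij n x)

theorem pair_subset_inversions {w : List (Fin θ)} {x : X} {i j : Fin θ} (hij : i ≠ j)
    (hi : al θ i ∈ inversions R w x) (hj : al θ j ∈ inversions R w x) :
    R.Δ x ∩ pairCone θ i j ⊆ inversions R w x := by
  rintro v ⟨hv, hc⟩
  refine ⟨hv, ((mem_pairCone_iff hij).mp hc).1, ?_⟩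
  obtain ⟨a, b, rfl⟩ := hc
  rw [map_add, map_smul, map_smul]
  exact add_nonpos (smul_nonpos_of_nonneg_of_nonpos (by positivity) hi.2.2)
    (smul_nonpos_of_nonneg_of_nonpos (by positivity) hj.2.2)

theorem pair_disjoint_inversions {w : List (Fin θ)} {x : X} {i j : Fin θ}
    (hi : al θ i ∉ inversions R w x) (hj : al θ j ∉ inversions R w x) {v : Fin θ → ℤ}
    (hv : v ∈ R.Δ x ∩ pairCone θ i j) : v ∉ inversions R w x := by
  rw [al_mem_inversions, not_nonpos_iff (R := R) i (invAct_mem_iff.mpr (al_mem _ _))] at hi hj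
  rintro ⟨-, -, h⟩
  refine (not_nonpos_iff (R := R) i (invAct_mem_iff.mpr hv.1)).mpr ?_ h
  obtain ⟨hv, a, b, rfl⟩ := hv
  rw [map_add, map_smul, map_smul]
  exact add_nonneg (smul_nonneg (by positivity) hi) (smul_nonneg (by positivity) hj)

theorem inversions_nil (x : X) (i : Fin θ) : inversions R [] x = ∅ := by
  ext v
  refine ⟨fun ⟨h, h0, h1⟩ => ?_, fun h => h.elim⟩
  exact (not_nonpos_iff i h).mpr h0 h1

/-- Alternating words of length at most `m_{ij}` have as many inversions as letters. -/
theorem ncard_inversions_altWord {i j : Fin θ} (hij : i ≠ j) {n : ℕ} {x : X}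
    (hn : n ≤ mnum G R x i j) :
    (inversions R (altWord i j n) x).ncard = n ∧ (0 < n → al θ i ∈ inversions R (altWord i j n) x) := by
  induction n generalizing i j x with
  | zero => simp [altWord, inversions_nil x i]
  | succ n ih =>
    have hm := mnum_swap_ρ (R := R) x hij
    obtain ⟨h1, h2⟩ := ih hij.symm (x := G.ρ i x) (by omega)
    have h3 : al θ i ∉ inversions R (altWord j i n) (G.ρ i x) := by
      intro h
      have hpos : 0 < n := by
        by_contra! h0
        obtain rfl : n = 0 := by omega
        rw [altWord, inversions_nil _ i] at h
        exact h
      have := Set.ncard_le_ncard (pair_subset_inversions hij.symm (h2 hpos) h)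
        (finite_inversions_altWord hij.symm n _)
      rw [h1] at this
      change mnum G R _ _ _ ≤ n at this
      omega
    refine ⟨?_, fun _ => al_mem_inversions_cons.mpr h3⟩
    rw [altWord, ncard_inversions_cons_of_notMem (finite_inversions_altWord hij (n + 1) x) h3, h1]

theorem inversions_altWord_mnum {i j : Fin θ} (hij : i ≠ j) (x : X) :
    inversions R (altWord i j (mnum G R x i j)) x = R.Δ x ∩ pairCone θ i j :=
  Set.eq_of_subset_of_ncard_le (inversions_altWord_subset hij _ x)
    (ncard_inversions_altWord hij le_rfl).1.ge (R.pairFinite x i j)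

theorem ncard_inversions_altWord_mnum_add {i j : Fin θ} (hij : i ≠ j) {q : ℕ} {x : X}
    (hq : q ≤ mnum G R x i j) :
    (inversions R (altWord i j (mnum G R x i j + q)) x).ncard + q = mnum G R x i j ∧
      (0 < q → al θ i ∉ inversions R (altWord i j (mnum G R x i j + q)) x) := by
  induction q generalizing i j x with
  | zero => simpa using (ncard_inversions_altWord hij le_rfl).1
  | succ q ih =>
    have hm := mnum_swap_ρ (R := R) x hij
    obtain ⟨h1, h2⟩ := ih hij.symm (x := G.ρ i x) (by omega)
    have h3 : al θ i ∈ inversions R (altWord j i (mnum G R x i j + q)) (G.ρ i x) := by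
      rw [hm] at h1 h2
      rcases Nat.eq_zero_or_pos q with rfl | hpos
      · rw [add_zero, ← hm, inversions_altWord_mnum hij.symm]
        exact ⟨al_mem _ _, al_mem_pairCone_right j i⟩
      · by_contra h
        have hempty : inversions R (altWord j i (mnum G R x i j + q)) (G.ρ i x) = ∅ :=
          Set.eq_empty_of_forall_notMem fun v hv =>
            pair_disjoint_inversions (h2 hpos) h
              (inversions_altWord_subset hij.symm _ _ hv) hv
        rw [hempty, Set.ncard_empty] at h1
        omega
    refine ⟨?_, fun _ h => al_mem_inversions_cons.mp h h3⟩
    have := ncard_inversions_cons_of_mem (finite_inversions_altWord hij.symm _ _) h3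
    rw [hm] at h1
    change (inversions R (i :: altWord j i (mnum G R x i j + q)) x).ncard + (q + 1) = _
    omega

theorem inversions_altWord_two_mul {i j : Fin θ} (hij : i ≠ j) (x : X) :
    inversions R (altWord i j (2 * mnum G R x i j)) x = ∅ := by
  have h := (ncard_inversions_altWord_mnum_add (R := R) hij (x := x) le_rfl).1
  rw [← Set.ncard_eq_zero (finite_inversions_altWord hij _ x), two_mul]
  omega

theorem sum_C_mul {i j : Fin θ} (hij : i ≠ j) (x : X) {u : Fin θ → ℤ}
    (hu : ∀ k, k ≠ i → k ≠ j → u k = 0) :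
    ∑ k, G.C x i k * u k = 2 * u i + G.C x i j * u j := by
  rw [Finset.sum_eq_add i j hij (fun k _ hk => by rw [hu k hk.1 hk.2, mul_zero])
    (by simp) (by simp), G.diag]

theorem invAct_altWord_det {i j : Fin θ} (hij : i ≠ j) (n : ℕ) (x : X) {u v : Fin θ → ℤ}
    (hu : ∀ k, k ≠ i → k ≠ j → u k = 0) (hv : ∀ k, k ≠ i → k ≠ j → v k = 0) :
    invAct G (altWord i j n) x u i * invAct G (altWord i j n) x v j -
      invAct G (altWord i j n) x u j * invAct G (altWord i j n) x v i =
    (-1) ^ n * (u i * v j - u j * v i) := by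
  induction n generalizing i j x u v with
  | zero => simp [altWord, invAct_nil]
  | succ n ih =>
    have hs : ∀ {u : Fin θ → ℤ}, (∀ k, k ≠ i → k ≠ j → u k = 0) →
        ∀ k, k ≠ j → k ≠ i → srefl G x i u k = 0 := fun hu k hj hi => by
      rw [srefl_apply_of_ne x hi, hu k hi hj]
    have := ih hij.symm (G.ρ i x) (hs hu) (hs hv)
    simp only [srefl_apply_self, srefl_apply_of_ne x hij.symm, sum_C_mul hij x hu,
      sum_C_mul hij x hv] at this
    simp only [altWord, invAct_cons]
    rw [pow_succ]
    linear_combination -this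

theorem nonneg_invAct_symm {w : List (Fin θ)} {x : X}
    (hw : inversions R w x = ∅) {v : Fin θ → ℤ} (hv : v ∈ R.Δ (wsrc G w x)) (h0 : 0 ≤ v) :
    0 ≤ (invAct G w x).symm v := by
  have hmem : (invAct G w x).symm v ∈ R.Δ x := by
    rw [← invAct_mem_iff (w := w), LinearEquiv.apply_symm_apply]
    exact hv
  refine (nonneg_or_nonpos hmem).resolve_right fun h => ?_
  have : -(invAct G w x).symm v ∈ inversions R w x := by
    refine ⟨neg_mem hmem, neg_nonneg.mpr h, ?_⟩
    rw [map_neg, LinearEquiv.apply_symm_apply]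
    exact neg_nonpos.mpr h0
  rw [hw] at this
  exact this

theorem eq_one_of_nonneg_inverse {p q r s a b c d : ℤ} (hp : 0 ≤ p) (hq : 0 ≤ q)
    (hr : 0 ≤ r) (hb : 0 ≤ b) (hc : 0 ≤ c)
    (hdet : p * s - q * r = 1) (h1 : a * p + b * r = 1) (h2 : a * q + b * s = 0)
    (h3 : c * p + d * r = 0) (h4 : c * q + d * s = 1) :
    p = 1 ∧ q = 0 ∧ r = 0 ∧ s = 1 := by
  have hb' : b = p * 0 - q := by linear_combination (-q) * h1 + p * h2 - b * hdet
  have hc' : c = -r := by linear_combination s * h3 - r * h4 - c * hdet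
  have hq0 : q = 0 := by linarith
  have hr0 : r = 0 := by linarith
  subst hq0 hr0
  have hps : p * s = 1 := by linarith
  have := Int.eq_one_or_neg_one_of_mul_eq_one hps
  have := Int.eq_one_or_neg_one_of_mul_eq_one' hps
  omega

/-- The linear maps satisfy the defining relations of the Weyl groupoid. -/
theorem invAct_altWord_two_mul (x : X) (i j : Fin θ) :
    invAct G (altWord i j (2 * mnum G R x i j)) x = LinearEquiv.refl ℤ _ := by
  by_cases hij : i = j
  · subst hij
    rw [mnum_self]
    ext1 v
    change srefl G (G.ρ i x) i (srefl G x i v) = v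
    rw [srefl_ρ, srefl_srefl]
  have hinv := inversions_altWord_two_mul (R := R) hij x
  have hdet := invAct_altWord_det (G := G) hij (2 * mnum G R x i j) x (u := al θ i) (v := al θ j)
    (fun k hi hj => by simp [al, hi]) (fun k hi hj => by simp [al, hj])
  have happ : ∀ k, k ≠ i → k ≠ j → ∀ v,
      invAct G (altWord i j (2 * mnum G R x i j)) x v k = v k :=
    fun k hi hj v => invAct_altWord_apply hi hj _ x v
  set w := altWord i j (2 * mnum G R x i j)
  set T := invAct G w x
  have hTnn : ∀ k, 0 ≤ T (al θ k) := fun k => by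
    rw [← not_nonpos_iff (R := R) i (invAct_mem_iff.mpr (al_mem _ k)), ← al_mem_inversions (R := R),
      hinv]
    exact Set.notMem_empty _
  have hTs : ∀ k, 0 ≤ T.symm (al θ k) := fun k =>
    nonneg_invAct_symm hinv (al_mem _ k) (al_nonneg k)
  have hsymm : ∀ k, k ≠ i → k ≠ j → ∀ v, T.symm v k = v k := fun k hi hj v => by
    rw [← happ k hi hj (T.symm v), LinearEquiv.apply_symm_apply]
  have hal : ∀ {k l : Fin θ}, k ≠ l → al θ l k = 0 := fun h => by simp [al, h]
  have hself : ∀ k, al θ k k = 1 := fun k => by simp [al]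
  have hexp : ∀ l, (l = i ∨ l = j) →
      al θ l = (T.symm (al θ l) i) • T (al θ i) + (T.symm (al θ l) j) • T (al θ j) := by
    intro l hl
    have h0 : ∀ k, k ≠ i → k ≠ j → T.symm (al θ l) k = 0 := fun k hi hj => by
      rw [hsymm k hi hj, hal]
      rcases hl with rfl | rfl <;> assumption
    conv_lhs => rw [← T.apply_symm_apply (al θ l), eq_smul_al_add_smul_al hij h0]
    rw [map_add, map_smul, map_smul]
  have hi := hexp i (Or.inl rfl)
  have hj := hexp j (Or.inr rfl)
  have key : T (al θ i) i = 1 ∧ T (al θ i) j = 0 ∧ T (al θ j) i = 0 ∧ T (al θ j) j = 1 := by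
    refine eq_one_of_nonneg_inverse (a := T.symm (al θ i) i) (d := T.symm (al θ j) j) (hTnn i i) (hTnn i j) (hTnn j i)
      (hTs i j) (hTs j i) ?_ ?_ ?_ ?_ ?_
    · rw [hdet, hself, hself, hal hij, hal (Ne.symm hij)]
      simp
    · simpa [hself] using (congrFun hi i).symm
    · simpa [hal (Ne.symm hij)] using (congrFun hi j).symm
    · simpa [hal hij] using (congrFun hj i).symm
    · simpa [hself] using (congrFun hj j).symm
  have hTi : T (al θ i) = al θ i := by
    rw [eq_smul_al_add_smul_al hij (v := T (al θ i))
      fun k hi hj => by rw [happ k hi hj, hal hi], key.1, key.2.1]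
    simp
  have hTj : T (al θ j) = al θ j := by
    rw [eq_smul_al_add_smul_al hij (v := T (al θ j))
      fun k hi hj => by rw [happ k hi hj, hal hj], key.2.2.1, key.2.2.2]
    simp
  have hTk : ∀ k, T (al θ k) = al θ k := by
    intro k
    by_cases hki : k = i
    · rw [hki, hTi]
    by_cases hkj : k = j
    · rw [hkj, hTj]
    have hd : T (al θ k) - al θ k =
        (T (al θ k) i) • al θ i + (T (al θ k) j) • al θ j := by
      conv_lhs => rw [eq_smul_al_add_smul_al hij (v := T (al θ k) - al θ k)
        fun l hi hj => by rw [Pi.sub_apply, happ l hi hj, sub_self]]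
      simp [hal (Ne.symm hki), hal (Ne.symm hkj)]
    have hs : T.symm (al θ k) =
        al θ k - ((T (al θ k) i) • al θ i + (T (al θ k) j) • al θ j) := by
      rw [LinearEquiv.symm_apply_eq, map_sub, map_add, map_smul, map_smul, hTi, hTj, ← hd]
      abel
    have hai : T (al θ k) i = 0 := by
      refine le_antisymm ?_ (hTnn k i)
      have := hTs k i
      rw [hs] at this
      simpa [hself, hal hij, hal (Ne.symm hki)] using this
    have haj : T (al θ k) j = 0 := by
      refine le_antisymm ?_ (hTnn k j)
      have := hTs k j
      rw [hs] at this
      simpa [hself, hal (Ne.symm hij), hal (Ne.symm hkj)] using this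
    rw [hai, haj, zero_smul, zero_smul, add_zero, sub_eq_zero] at hd
    exact hd
  apply LinearEquiv.toLinearMap_injective
  refine (Pi.basisFun ℤ (Fin θ)).ext fun k => ?_
  rw [Pi.basisFun_apply]
  exact hTk k

end Roots

end WeylGroupoid
namespace WeylGroupoid

section Exchange

variable {θ : ℕ} {X : Type} [Fintype X] [DecidableEq X] {G : SCG θ X} {R : GRS G}

variable (G) in
/-- The action of paths on `ℤ^θ`, as a functor. -/
def pathAct : Paths (Obj G) ⥤ SingleObj ((Fin θ → ℤ) ≃ₗ[ℤ] (Fin θ → ℤ))ᵐᵒᵖ :=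
  Paths.lift
    { obj := fun _ => SingleObj.star _
      map := fun {_ b} e => MulOpposite.op (sreflEquiv G (show X from b) e.1) }

theorem pathAct_map_pathOf (w : List (Fin θ)) (x : X) :
    (pathAct G).map (pathOf G w x) = MulOpposite.op (invAct G w x) := by
  induction w generalizing x with
  | nil => rfl
  | cons i l ih =>
    refine ((pathAct G).map_comp _ _).trans ?_
    exact congrArg (fun f => MulOpposite.op (sreflEquiv G x i) * f) (ih (G.ρ i x))

theorem pathAct_map_castSrc {a b c : X} (h : a = b) (f : pob G a ⟶ pob G c) :
    (pathAct G).map (castSrc G h f) = ((pathAct G).map f : _) := by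
  subst h
  rfl

variable (G R) in
/-- The action of the Weyl groupoid on `ℤ^θ`, as a functor. -/
def groupoidAct : CategoryTheory.Quotient (wrel G R) ⥤
    SingleObj ((Fin θ → ℤ) ≃ₗ[ℤ] (Fin θ → ℤ))ᵐᵒᵖ :=
  CategoryTheory.Quotient.lift (wrel G R) (pathAct G) <| by
    rintro _ _ _ _ ⟨x, i, j, h⟩
    rw [pathAct_map_castSrc, pathAct_map_pathOf, invAct_altWord_two_mul]
    exact ((pathAct G).map_id _).symm

theorem invAct_eq_of_elt_eq {w v : List (Fin θ)} {x : X} (h : elt G R w x = elt G R v x) :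
    invAct G w x = invAct G v x := by
  let F : (Σ y, homW G R y x) → ((Fin θ → ℤ) ≃ₗ[ℤ] (Fin θ → ℤ))ᵐᵒᵖ :=
    fun p => (groupoidAct G R).map p.2
  have key : ∀ w, F (elt G R w x) = MulOpposite.op (invAct G w x) := fun w =>
    pathAct_map_pathOf w x
  exact MulOpposite.op_injective (by rw [← key, ← key, h])

theorem inversions_eq_of_elt_eq {w v : List (Fin θ)} {x : X} (h : elt G R w x = elt G R v x) :
    inversions R w x = inversions R v x := by
  unfold inversions
  rw [invAct_eq_of_elt_eq h]

/-- The exchange property for words shorter than `n`. -/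
def ExchangeBelow (R : GRS G) (n : ℕ) : Prop :=
  ∀ (x : X) (w : List (Fin θ)) (i : Fin θ), w.length < n → al θ i ∈ inversions R w x →
    ∃ l, elt G R w x = elt G R (i :: l) x ∧ l.length < w.length

theorem ExchangeBelow.exists_altWord_append {N : ℕ} (H : ExchangeBelow R N) {i j : Fin θ}
    (hij : i ≠ j) {q : ℕ} {x : X} {w : List (Fin θ)} (hq : q ≤ mnum G R x i j)
    (hw : w.length < N) (hsub : inversions R (altWord i j q) x ⊆ inversions R w x) :
    ∃ v, elt G R w x = elt G R (altWord i j q ++ v) x ∧ q + v.length ≤ w.length := by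
  induction q generalizing i j x w with
  | zero => exact ⟨w, rfl, by simp⟩
  | succ q ih =>
    have hi : al θ i ∈ inversions R (i :: altWord j i q) x :=
      (ncard_inversions_altWord hij hq).2 q.succ_pos
    obtain ⟨l, hl, hlen⟩ := H x w i hw (hsub hi)
    have hm := mnum_swap_ρ (R := R) x hij
    obtain ⟨v, hv, hvlen⟩ := ih hij.symm (x := G.ρ i x) (w := l) (by omega) (by omega) <| by
      intro β hβ
      have hne : β ≠ al θ i := by
        rintro rfl
        exact al_mem_inversions_cons.mp hi hβ
      have h1 := hsub (srefl_mem_inversions_cons hβ hne)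
      rw [inversions_eq_of_elt_eq hl] at h1
      have h2 := srefl_mem_inversions h1 <| by
        have := (srefl_nonneg (G := G) hβ.1 hβ.2.1 hne).2
        rwa [srefl_ρ] at this
      rwa [srefl_srefl] at h2
    exact ⟨v, hl.trans (elt_cons_congr hv), by omega⟩

theorem exchangeBelow (R : GRS G) (n : ℕ) : ExchangeBelow R n := by
  induction n with
  | zero => exact fun _ _ _ h => absurd h (Nat.not_lt_zero _)
  | succ n ih =>
    intro x w i hw hi
    rcases w with _ | ⟨j, l⟩
    · rw [inversions_nil x i] at hi
      exact hi.elim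
    rw [List.length_cons] at hw
    by_cases hij : j = i
    · subst hij
      exact ⟨l, rfl, by simp⟩
    by_cases hj : al θ j ∈ inversions R (j :: l) x
    · have hm := mnum_swap_ρ (R := R) x hij
      have hpos := mnum_pos (R := R) x j i
      have halt : altWord j i (mnum G R x j i) = j :: altWord i j (mnum G R x j i - 1) := by
        conv_lhs => rw [← Nat.sub_add_cancel hpos]
        rfl
      have hinv := inversions_altWord_mnum (R := R) hij x
      rw [halt] at hinv
      have hj' : al θ j ∈ inversions R (j :: altWord i j (mnum G R x j i - 1)) x := by
        rw [hinv]
        exact ⟨al_mem x j, al_mem_pairCone_left j i⟩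
      obtain ⟨v, hv, hvlen⟩ := ih.exists_altWord_append (Ne.symm hij) (x := G.ρ j x) (w := l)
        (q := mnum G R x j i - 1) (by omega) (by omega) <| by
          intro β hβ
          have hne : β ≠ al θ j := by
            rintro rfl
            exact al_mem_inversions_cons.mp hj' hβ
          have h1 := srefl_mem_inversions_cons hβ hne
          rw [hinv] at h1
          have h2 := srefl_mem_inversions (pair_subset_inversions hij hj hi h1) <| by
            have := (srefl_nonneg (G := G) hβ.1 hβ.2.1 hne).2
            rwa [srefl_ρ] at this
          rwa [srefl_srefl] at h2
      refine ⟨altWord j i (mnum G R x j i - 1) ++ v, ?_, ?_⟩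
      · have h1 : elt G R (j :: l) x = elt G R (altWord j i (mnum G R x j i) ++ v) x := by
          rw [halt]
          exact elt_cons_congr hv
        rw [h1, elt_append_congr (elt_altWord_comm x j i), ← List.cons_append]
        conv_lhs => rw [← Nat.sub_add_cancel hpos]
        rfl
      · simp only [List.length_append, length_altWord, List.length_cons]
        omega
    · have hj' : al θ j ∈ inversions R l (G.ρ j x) := by
        rwa [al_mem_inversions_cons, not_not] at hj
      obtain ⟨l', hl', hlen'⟩ := ih _ l j (by omega) hj'
      have h1 : elt G R (j :: l) x = elt G R l' x :=
        (elt_cons_congr hl').trans (elt_cons_cons_self j l' x)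
      rw [inversions_eq_of_elt_eq h1] at hi
      obtain ⟨l'', hl'', hlen''⟩ := ih x l' i (by omega) hi
      exact ⟨l'', h1.trans hl'', by rw [List.length_cons]; omega⟩

/-- If two simple roots are inversions of a word, then the alternating word of length
`m_{ij}` can be split off. -/
theorem exists_altWord_mnum_append {x : X} {w : List (Fin θ)} {i j : Fin θ} (hij : i ≠ j)
    (hi : al θ i ∈ inversions R w x) (hj : al θ j ∈ inversions R w x) :
    ∃ v, elt G R w x = elt G R (altWord i j (mnum G R x i j) ++ v) x ∧
      mnum G R x i j + v.length ≤ w.length := by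
  refine (exchangeBelow R (w.length + 1)).exists_altWord_append hij le_rfl (Nat.lt_succ_self _) ?_
  rw [inversions_altWord_mnum hij]
  exact pair_subset_inversions hij hi hj

variable (R) in
/-- A word is reduced if it is a shortest word for its morphism. -/
def Reduced (w : List (Fin θ)) (x : X) : Prop :=
  ∀ v, elt G R v x = elt G R w x → w.length ≤ v.length

theorem Reduced.of_elt_eq {w v : List (Fin θ)} {x : X} (hw : Reduced R w x)
    (h : elt G R v x = elt G R w x) (hlen : v.length ≤ w.length) : Reduced R v x :=
  fun t ht => hlen.trans (hw t (ht.trans h))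

theorem Reduced.of_append_right {w v : List (Fin θ)} {x : X} (h : Reduced R (w ++ v) x) :
    Reduced R v (wsrc G w x) := by
  intro t ht
  have := h (w ++ t) (elt_append_congr_right ht)
  simpa using this

theorem Reduced.of_append_left {w v : List (Fin θ)} {x : X} (h : Reduced R (w ++ v) x) :
    Reduced R w x := by
  intro t ht
  have := h (t ++ v) (elt_append_congr ht)
  simpa using this

theorem Reduced.of_cons {i : Fin θ} {l : List (Fin θ)} {x : X} (h : Reduced R (i :: l) x) :
    Reduced R l (G.ρ i x) :=
  Reduced.of_append_right (w := [i]) h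

theorem Reduced.isChain_ne {w : List (Fin θ)} {x : X} (h : Reduced R w x) :
    w.IsChain (· ≠ ·) := by
  induction w generalizing x with
  | nil => exact .nil
  | cons i l ih =>
    rcases l with _ | ⟨j, l⟩
    · exact .singleton i
    · refine .cons_cons ?_ (ih h.of_cons)
      rintro rfl
      have := h l (elt_cons_cons_self i l x).symm
      simp at this

theorem Reduced.al_mem_inversions {i : Fin θ} {l : List (Fin θ)} {x : X}
    (h : Reduced R (i :: l) x) : al θ i ∈ inversions R (i :: l) x := by
  rw [al_mem_inversions_cons]
  intro hi
  obtain ⟨l', hl', hlen⟩ := exchangeBelow R _ _ l i (Nat.lt_succ_self _) hi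
  have := h l' ((elt_cons_cons_self i l' x).symm.trans (elt_cons_congr hl').symm)
  rw [List.length_cons] at this
  omega

end Exchange

end WeylGroupoid
namespace WeylGroupoid

section GoodSubwords

variable {θ : ℕ} {X : Type} [Fintype X] [DecidableEq X] {G : SCG θ X} {R : GRS G}

variable (G) in
/-- `GoodSubword G x w v`: the word `v` arises from the word `w` with target `x` by omitting
letters which do not change the object. -/
inductive GoodSubword : X → List (Fin θ) → List (Fin θ) → Prop
  | nil (x : X) : GoodSubword x [] []
  | keep {x : X} {i : Fin θ} {l v : List (Fin θ)} :
      GoodSubword (G.ρ i x) l v → GoodSubword x (i :: l) (i :: v)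
  | skip {x : X} {i : Fin θ} {l v : List (Fin θ)} :
      G.ρ i x = x → GoodSubword x l v → GoodSubword x (i :: l) v

theorem GoodSubword.refl (x : X) (w : List (Fin θ)) : GoodSubword G x w w := by
  induction w generalizing x with
  | nil => exact .nil x
  | cons i l ih => exact .keep (ih _)

theorem GoodSubword.length_le {x : X} {w v : List (Fin θ)} (h : GoodSubword G x w v) :
    v.length ≤ w.length := by
  induction h with
  | nil => rfl
  | keep _ ih => simpa using ih
  | skip _ _ ih => exact ih.trans (by simp)

theorem GoodSubword.append {x : X} {a b v v' : List (Fin θ)} (h : GoodSubword G x a v)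
    (h' : GoodSubword G (wsrc G a x) b v') : GoodSubword G x (a ++ b) (v ++ v') := by
  induction h with
  | nil => exact h'
  | keep _ ih => exact .keep (ih h')
  | skip hx _ ih =>
    rw [wsrc, hx] at h'
    exact .skip hx (ih h')

theorem GoodSubword.exists_of_append {x : X} {a b v : List (Fin θ)}
    (h : GoodSubword G x (a ++ b) v) :
    ∃ v₁ v₂, v = v₁ ++ v₂ ∧ GoodSubword G x a v₁ ∧ GoodSubword G (wsrc G a x) b v₂ := by
  induction a generalizing x v with
  | nil => exact ⟨[], v, rfl, .nil x, h⟩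
  | cons i a ih =>
    rcases h with _ | h | ⟨hx, h⟩
    · obtain ⟨v₁, v₂, rfl, h1, h2⟩ := ih h
      exact ⟨i :: v₁, v₂, rfl, .keep h1, h2⟩
    · obtain ⟨v₁, v₂, rfl, h1, h2⟩ := ih h
      refine ⟨v₁, v₂, rfl, .skip hx h1, ?_⟩
      rwa [wsrc, hx]

theorem goodSubword_altWord_nil {x : X} {i j : Fin θ} (hi : G.ρ i x = x) (hj : G.ρ j x = x)
    (n : ℕ) : GoodSubword G x (altWord i j n) [] := by
  induction n generalizing i j with
  | zero => exact .nil x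
  | succ n ih => exact .skip hi (ih hj hi)

theorem goodSubword_altWord_of_le {x : X} {i j : Fin θ} (hi : G.ρ i x = x) (hj : G.ρ j x = x)
    {t n : ℕ} (h : t ≤ n) : GoodSubword G x (altWord i j n) (altWord i j t) := by
  induction t generalizing i j n with
  | zero => exact goodSubword_altWord_nil hi hj n
  | succ t ih =>
    obtain ⟨n, rfl⟩ : ∃ k, n = k + 1 := ⟨n - 1, by omega⟩
    refine .keep ?_
    rw [hi]
    exact ih hj hi (by omega)

theorem GoodSubword.altWord_of_fixed {x : X} {i j : Fin θ} (hi : G.ρ i x = x)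
    (hj : G.ρ j x = x) {n : ℕ} {v : List (Fin θ)} (h : GoodSubword G x (altWord i j n) v)
    (hv : v.IsChain (· ≠ ·)) : ∃ t, v = altWord i j t ∨ v = altWord j i t := by
  induction n generalizing i j v with
  | zero =>
    cases h
    exact ⟨0, Or.inl rfl⟩
  | succ n ih =>
    rcases h with _ | @⟨_, _, _, v, h⟩ | ⟨_, h⟩
    · rw [hi] at h
      obtain ⟨t, rfl | rfl⟩ := ih hj hi h hv.tail
      · exact ⟨t + 1, Or.inl rfl⟩
      · rcases t with _ | t
        · exact ⟨1, Or.inl rfl⟩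
        · simp [altWord] at hv
    · obtain ⟨t, ht⟩ := ih hj hi h hv
      exact ⟨t, ht.symm⟩

/-- The good subwords without repetitions of an alternating word: unless both involutions fix
the object, only the outermost letters can be omitted. -/
theorem GoodSubword.altWord_cases {x : X} {i j : Fin θ} {n : ℕ} {v : List (Fin θ)}
    (h : GoodSubword G x (altWord i j n) v) (hv : v.IsChain (· ≠ ·)) :
    v = altWord i j n ∨ (G.ρ i x = x ∧ G.ρ j x = x) ∨
    (∃ k, n = k + 1 ∧ G.ρ i x = x ∧ v = altWord j i k) ∨
    (∃ k, n = k + 1 ∧ wsrc G (altWord i j (k + 1)) x = wsrc G (altWord i j k) x ∧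
      v = altWord i j k) ∨
    (∃ k, n = k + 2 ∧ G.ρ i x = x ∧
      wsrc G (altWord i j (k + 2)) x = wsrc G (altWord i j (k + 1)) x ∧ v = altWord j i k) := by
  induction n generalizing i j x v with
  | zero =>
    cases h
    exact Or.inl rfl
  | succ n ih =>
    rcases h with _ | @⟨_, _, _, v, h⟩ | ⟨hi, h⟩
    · obtain rfl | ⟨h1, h2⟩ | ⟨k, rfl, h1, rfl⟩ | ⟨k, rfl, h1, rfl⟩ | ⟨k, rfl, h1, h2, rfl⟩ :=
        ih h hv.tail
      · exact Or.inl rfl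
      · rw [G.invol] at h2
        rw [← h2] at h1
        exact Or.inr (Or.inl ⟨h2.symm, h1⟩)
      · rcases k with _ | k
        · exact Or.inr (Or.inr (Or.inr (Or.inl ⟨1, rfl, h1, rfl⟩)))
        · simp [altWord] at hv
      · exact Or.inr (Or.inr (Or.inr (Or.inl ⟨k + 1, rfl, h1, rfl⟩)))
      · rcases k with _ | k
        · simp only [altWord, wsrc, h1, G.invol] at h2
          rw [← h2] at h1
          exact Or.inr (Or.inl ⟨h2.symm, h1⟩)
        · simp [altWord] at hv
    · obtain rfl | ⟨h1, h2⟩ | ⟨k, rfl, h1, rfl⟩ | ⟨k, rfl, h1, rfl⟩ | ⟨k, rfl, h1, h2, rfl⟩ :=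
        ih h hv
      · exact Or.inr (Or.inr (Or.inl ⟨n, rfl, hi, rfl⟩))
      · exact Or.inr (Or.inl ⟨h2, h1⟩)
      · exact Or.inr (Or.inl ⟨hi, h1⟩)
      · refine Or.inr (Or.inr (Or.inr (Or.inr ⟨k, rfl, hi, ?_, rfl⟩)))
        change wsrc G (altWord j i (k + 1)) (G.ρ i x) = wsrc G (altWord j i k) (G.ρ i x)
        rwa [hi]
      · exact Or.inr (Or.inl ⟨hi, h1⟩)

/-- `w₂` has every reduced good subword of `w₁`, up to equality in the Weyl groupoid. -/
def Dominates (R : GRS G) (x : X) (w₁ w₂ : List (Fin θ)) : Prop :=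
  ∀ v, GoodSubword G x w₁ v → Reduced R v x →
    ∃ v', GoodSubword G x w₂ v' ∧ v'.length = v.length ∧ elt G R v' x = elt G R v x

theorem Dominates.refl (x : X) (w : List (Fin θ)) : Dominates R x w w :=
  fun v h _ => ⟨v, h, rfl, rfl⟩

theorem Dominates.trans {x : X} {w₁ w₂ w₃ : List (Fin θ)} (h : Dominates R x w₁ w₂)
    (h' : Dominates R x w₂ w₃) : Dominates R x w₁ w₃ := by
  intro v hv hr
  obtain ⟨v', h1, h2, h3⟩ := h v hv hr
  obtain ⟨v'', h4, h5, h6⟩ := h' v' h1 (hr.of_elt_eq h3 h2.le)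
  exact ⟨v'', h4, h5.trans h2, h6.trans h3⟩

theorem Dominates.cons {x : X} {i : Fin θ} {w₁ w₂ : List (Fin θ)}
    (h : Dominates R (G.ρ i x) w₁ w₂) : Dominates R x (i :: w₁) (i :: w₂) := by
  intro v hv hr
  rcases hv with _ | hv | ⟨hi, hv⟩
  · obtain ⟨v', h1, h2, h3⟩ := h _ hv hr.of_cons
    exact ⟨i :: v', .keep h1, by simp [h2], elt_cons_congr h3⟩
  · rw [hi] at h
    obtain ⟨v', h1, h2, h3⟩ := h v hv hr
    exact ⟨v', .skip hi h1, h2, h3⟩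

theorem dominates_altWord (x : X) (i j : Fin θ) :
    Dominates R x (altWord i j (mnum G R x i j)) (altWord j i (mnum G R x i j)) := by
  intro v hv hr
  have hlen := hv.length_le
  have hsrc := wsrc_eq_of_elt_eq (elt_altWord_comm (R := R) x i j)
  have hcomm := elt_altWord_comm (R := R) x i j
  rw [length_altWord] at hlen
  set m := mnum G R x i j
  have hfull : ∃ v', GoodSubword G x (altWord j i m) v' ∧ v'.length = (altWord i j m).length ∧
      elt G R v' x = elt G R (altWord i j m) x :=
    ⟨_, .refl x _, by simp [length_altWord], hcomm.symm⟩
  have hfixed (hi : G.ρ i x = x) (hj : G.ρ j x = x) :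
      ∃ v', GoodSubword G x (altWord j i m) v' ∧ v'.length = v.length ∧
        elt G R v' x = elt G R v x := by
    obtain ⟨t, rfl | rfl⟩ := hv.altWord_of_fixed hi hj hr.isChain_ne
    · rw [length_altWord] at hlen
      rcases hlen.eq_or_lt with rfl | hlt
      · exact hfull
      · obtain ⟨k, hk⟩ : ∃ k, m = k + 1 := ⟨m - 1, by omega⟩
        rw [hk]
        exact ⟨_, .skip hj (goodSubword_altWord_of_le hi hj (by omega)), rfl, rfl⟩
    · rw [length_altWord] at hlen
      exact ⟨_, goodSubword_altWord_of_le hj hi hlen, rfl, rfl⟩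
  have hlast {k : ℕ} (hk : m = k + 1)
      (h : wsrc G (altWord i j (k + 1)) x = wsrc G (altWord i j k) x) : G.ρ j x = x := by
    rw [hk, h] at hsrc
    exact (wsrc_injective _ hsrc).symm
  obtain rfl | ⟨hi, hj⟩ | ⟨k, hk, hi, rfl⟩ | ⟨k, hk, h, rfl⟩ | ⟨k, hk, hi, h, rfl⟩ :=
    hv.altWord_cases hr.isChain_ne
  · exact hfull
  · exact hfixed hi hj
  · refine ⟨_, ?_, rfl, rfl⟩
    rw [hk] at hsrc ⊢
    have h1 : wsrc G (altWord j i (k + 1)) x = wsrc G (altWord j i k) x := by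
      rw [← hsrc, altWord, wsrc, hi]
    rw [altWord_add] at h1 ⊢
    rw [wsrc_append] at h1
    conv => arg 4; rw [← List.append_nil (altWord j i k)]
    refine .append (.refl x _) ?_
    split_ifs at h1 ⊢
    · exact .skip h1 (.nil _)
    · exact .skip h1 (.nil _)
  · rw [hk]
    exact ⟨_, .skip (hlast hk h) (.refl x _), rfl, rfl⟩
  · exact hfixed hi (hlast hk h)

theorem Dominates.append_right {x : X} {w₁ w₂ : List (Fin θ)} (h : Dominates R x w₁ w₂)
    (hsrc : wsrc G w₁ x = wsrc G w₂ x) (b : List (Fin θ)) :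
    Dominates R x (w₁ ++ b) (w₂ ++ b) := by
  intro v hv hr
  obtain ⟨v₁, v₂, rfl, h1, h2⟩ := hv.exists_of_append
  obtain ⟨v', h3, h4, h5⟩ := h v₁ h1 hr.of_append_left
  rw [hsrc] at h2
  exact ⟨v' ++ v₂, h3.append h2, by simp [h4], elt_append_congr h5⟩

/-- Two reduced words for the same morphism have the same reduced good subwords. -/
theorem dominates_of_reduced {x : X} {w₁ w₂ : List (Fin θ)} (h₁ : Reduced R w₁ x)
    (h₂ : Reduced R w₂ x) (h : elt G R w₁ x = elt G R w₂ x) : Dominates R x w₁ w₂ := by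
  obtain ⟨n, hn⟩ : ∃ n, w₁.length = n := ⟨_, rfl⟩
  have hlen : w₁.length = w₂.length := le_antisymm (h₁ w₂ h.symm) (h₂ w₁ h)
  induction n generalizing x w₁ w₂ with
  | zero =>
    rw [List.eq_nil_of_length_eq_zero hn, List.eq_nil_of_length_eq_zero (hlen.symm.trans hn)]
    exact .refl x _
  | succ n ih =>
    have same_head : ∀ {i : Fin θ} {a b : List (Fin θ)}, Reduced R (i :: a) x →
        Reduced R (i :: b) x → elt G R (i :: a) x = elt G R (i :: b) x → a.length = n →
        b.length = n → Dominates R x (i :: a) (i :: b) := fun ha hb hab hna hnb =>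
      .cons (ih ha.of_cons hb.of_cons (elt_of_cons_eq hab) hna (hna.trans hnb.symm))
    rcases w₁ with _ | ⟨i, a⟩
    · simp at hn
    rcases w₂ with _ | ⟨j, b⟩
    · simp at hlen
    simp only [List.length_cons, add_left_inj] at hn hlen
    by_cases hij : i = j
    · subst hij
      exact same_head h₁ h₂ h hn (hlen.symm.trans hn)
    have hi := h₁.al_mem_inversions
    have hj := h₂.al_mem_inversions
    rw [← inversions_eq_of_elt_eq h] at hj
    obtain ⟨v, hv, hvlen⟩ := exists_altWord_mnum_append hij hi hj
    have hbraid := (dominates_altWord (R := R) x i j).append_right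
      (wsrc_eq_of_elt_eq (elt_altWord_comm (R := R) x i j)) v
    have hcomm := elt_append_congr (v := v) (elt_altWord_comm (R := R) x i j)
    obtain ⟨m, hm⟩ : ∃ m, mnum G R x i j = m + 1 :=
      ⟨mnum G R x i j - 1, by have := mnum_pos (R := R) x i j; omega⟩
    rw [hm] at hv hvlen hbraid hcomm
    have hc := h₁ _ hv.symm
    simp only [List.length_append, length_altWord, List.length_cons] at hvlen hc
    have hred : Reduced R (altWord i j (m + 1) ++ v) x :=
      h₁.of_elt_eq hv.symm (by simp only [List.length_append, length_altWord, List.length_cons]; omega)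
    have hred' : Reduced R (altWord j i (m + 1) ++ v) x :=
      hred.of_elt_eq hcomm.symm (by simp only [List.length_append, length_altWord]; omega)
    refine .trans ?_ (hbraid.trans ?_)
    · refine same_head h₁ hred hv hn ?_
      simp only [List.append_eq, List.length_append, length_altWord]
      omega
    · refine same_head hred' h₂ (hcomm.symm.trans (hv.symm.trans h)) ?_ (hlen.symm.trans hn)
      simp only [List.append_eq, List.length_append, length_altWord]
      omega

theorem subword_cons (i : Fin θ) (l : List (Fin θ)) (s : Finset (Fin (i :: l).length)) :
    subword (i :: l) s = (if (0 : Fin (l.length + 1)) ∈ s then [i] else []) ++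
      subword l (Finset.univ.filter fun k : Fin l.length => k.succ ∈ s) := by
  have h : List.finRange (i :: l).length = 0 :: (List.finRange l.length).map Fin.succ :=
    List.finRange_succ
  unfold subword
  rw [h, List.filter_cons, List.filter_map, apply_ite (List.map _), List.map_cons, List.map_map]
  have : (fun k => decide (k ∈ s)) ∘ Fin.succ = fun k : Fin l.length =>
      decide (k ∈ Finset.univ.filter fun k : Fin l.length => k.succ ∈ s) := by
    funext k
    simp
  rw [this]
  split_ifs <;> simp_all

theorem length_subword (w : List (Fin θ)) (s : Finset (Fin w.length)) :
    (subword w s).length = s.card := by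
  unfold subword
  rw [List.length_map, ← List.toFinset_card_of_nodup ((List.nodup_finRange _).filter _)]
  congr 1
  ext k
  simp

theorem goodSubword_iff {w v : List (Fin θ)} {x : X} :
    GoodSubword G x w v ↔ ∃ s, IsGood G w x s ∧ subword w s = v := by
  induction w generalizing x v with
  | nil =>
    constructor
    · intro h
      cases h
      exact ⟨∅, fun z => z.elim0, rfl⟩
    · rintro ⟨s, -, rfl⟩
      exact .nil x
  | cons i l ih =>
    constructor
    · intro h
      rcases h with _ | h | ⟨hi, h⟩
      · obtain ⟨s, hs, rfl⟩ := ih.mp h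
        refine ⟨Finset.univ.filter fun k : Fin (l.length + 1) =>
          Fin.cons (α := fun _ => Bool) true (fun k => decide (k ∈ s)) k, ?_, ?_⟩
        · intro z
          refine Fin.cases ?_ (fun z => ?_) z
          · simp
          · intro hz
            exact hs z (by simpa using hz)
        · rw [subword_cons]
          simp
      · obtain ⟨s, hs, rfl⟩ := ih.mp h
        refine ⟨Finset.univ.filter fun k : Fin (l.length + 1) =>
          Fin.cons (α := fun _ => Bool) false (fun k => decide (k ∈ s)) k, ?_, ?_⟩
        · intro z
          refine Fin.cases ?_ (fun z => ?_) z
          · exact fun _ => hi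
          · intro hz
            have := hs z (by simpa using hz)
            rw [← hi] at this
            exact this
        · rw [subword_cons]
          simp
    · rintro ⟨s, hs, rfl⟩
      have htail : GoodSubword G (G.ρ i x) l
          (subword l (Finset.univ.filter fun k : Fin l.length => k.succ ∈ s)) :=
        ih.mpr ⟨_, fun z hz => hs z.succ (by simpa using hz), rfl⟩
      rw [subword_cons]
      split_ifs with h0
      · exact .keep htail
      · have hi : G.ρ i x = x := hs (0 : Fin (l.length + 1)) h0
        rw [hi] at htail
        exact .skip hi htail

theorem reduced_of_len_eq {w : List (Fin θ)} {y x : X} {f : homW G R y x}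
    (h : elt G R w x = ⟨y, f⟩) (hlen : len G R f = w.length) : Reduced R w x := by
  intro v hv
  rw [← hlen]
  exact Nat.sInf_le ⟨v, rfl, elt_eq_iff.mp (hv.trans h)⟩

end GoodSubwords

end WeylGroupoid

namespace WeylGroupoid

/-- **The Bruhat order of a Weyl groupoid is well defined (Theorem 5.2).**
Let `w ∈ 𝒲(y,x)` with `ℓ(w) = r > 0` and let
`w = σ_{i_1}^{x_1} ⋯ σ_{i_r}^{x_r} = σ_{j_1}^x ⋯ σ_{j_r}` be two reduced expressions.
Then for every `(y,x)`-good subsequence of the first reduced expression whose subword is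
a reduced expression of some `u ∈ 𝒲(y,x)`, there is a `(y,x)`-good subsequence of the
second reduced expression whose subword is a reduced expression of the same `u`.
Consequently the Bruhat order on `𝒲(y,x)` does not depend on the chosen reduced
expression. -/
theorem bruhat_order_well_defined {θ : ℕ} {X : Type} [Fintype X] [DecidableEq X]
    (G : SCG θ X) (R : GRS G)
    (y x : X) (w : homW G R y x) (r : ℕ) (hr : len G R w = r) (hpos : 0 < r)
    (w₁ w₂ : List (Fin θ)) (hw₁len : w₁.length = r) (hw₂len : w₂.length = r)
    (hw₁ : ∃ h : wsrc G w₁ x = y, castW G R h (morW G R w₁ x) = w)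
    (hw₂ : ∃ h : wsrc G w₂ x = y, castW G R h (morW G R w₂ x) = w)
    (s₁ : Finset (Fin w₁.length)) (hgood₁ : IsGood G w₁ x s₁)
    (u : homW G R y x)
    (hu : ∃ h : wsrc G (subword w₁ s₁) x = y,
      castW G R h (morW G R (subword w₁ s₁) x) = u)
    (hured : len G R u = s₁.card) :
    ∃ s₂ : Finset (Fin w₂.length), IsGood G w₂ x s₂ ∧ s₂.card = s₁.card ∧
      ∃ h : wsrc G (subword w₂ s₂) x = y,
        castW G R h (morW G R (subword w₂ s₂) x) = u := by
  subst hr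
  obtain ⟨v, hv, hlen, helt⟩ := dominates_of_reduced
    (reduced_of_len_eq (elt_eq_iff.mpr hw₁) hw₁len.symm)
    (reduced_of_len_eq (elt_eq_iff.mpr hw₂) hw₂len.symm)
    ((elt_eq_iff.mpr hw₁).trans (elt_eq_iff.mpr hw₂).symm) _ (goodSubword_iff.mpr ⟨s₁, hgood₁, rfl⟩)
    (reduced_of_len_eq (elt_eq_iff.mpr hu) (hured.trans (length_subword w₁ s₁).symm))
  obtain ⟨s₂, hs₂, rfl⟩ := goodSubword_iff.mp hv
  rw [length_subword, length_subword] at hlen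
  exact ⟨s₂, hs₂, hlen, elt_eq_iff.mp (helt.trans (elt_eq_iff.mpr hu))⟩

end WeylGroupoid
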